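/- For all partitions λ, μ, ν, the Aguiar coefficient a_{λ,μ}^ν equals the sum over all six-tuples of partitions (α, β, δ, η, ρ, τ) of the product c_{α,β}^λ · c_{η,ρ}^μ · g_{β,η,δ} · c_{α,δ}^τ · c_{τ,ρ}^ν, where c denotes Littlewood–Richardson coefficients and g denotes Kronecker coefficients. -/

import Mathlib

open scoped BigOperators
open scoped Classical

/-- A partition: a finitely supported antitone sequence of natural numbers
(the parts, indexed from 0). -/
def IsPartitionFun (f : ℕ →₀ ℕ) : Prop := ∀ ⦃i j : ℕ⦄, i ≤ j → f j ≤ f i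

def Partition' : Type := {f : ℕ →₀ ℕ // IsPartitionFun f}

namespace Partition'

/-- The size `|λ|` of a partition. -/
def size (l : Partition') : ℕ := l.1.sum fun _ v => v

/-- The number of (nonzero) parts of a partition. -/
def plength (l : Partition') : ℕ := l.1.support.card

noncomputable instance : Add Partition' :=
  ⟨fun l m => ⟨l.1 + m.1, fun i j h => by
    simp only [Finsupp.add_apply]
    exact add_le_add (l.2 h) (m.2 h)⟩⟩

noncomputable instance : SMul ℕ Partition' :=
  ⟨fun d l => ⟨d • l.1, fun i j h => by
    simp only [Finsupp.smul_apply, smul_eq_mul]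
    exact Nat.mul_le_mul_left d (l.2 h)⟩⟩

/-- The one-row partition `(m)`. For `m = 0` this is the empty partition. -/
noncomputable def row (m : ℕ) : Partition' :=
  ⟨Finsupp.single 0 m, by
    intro i j h
    simp only [Finsupp.single_apply]
    split_ifs <;> omega⟩

/-- The two-row partition `(a, b)` (with `b ≤ a`). -/
noncomputable def twoRow (a b : ℕ) (hba : b ≤ a) : Partition' :=
  ⟨Finsupp.single 0 a + Finsupp.single 1 b, by
    intro i j h
    simp only [Finsupp.add_apply, Finsupp.single_apply]
    split_ifs <;> omega⟩

/-- `youngCount n a g` is the number of fixed points of the permutation `g` acting on the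
set of functions `Fin n → Fin n` whose fibre over `i` has exactly `a i` elements; i.e. the
value at `g` of the permutation character of `S_n` acting on cosets of the Young subgroup
attached to the composition `a`. It is `0` if some `a i` is negative. -/
noncomputable def youngCount (n : ℕ) (a : Fin n → ℤ) (g : Equiv.Perm (Fin n)) : ℤ :=
  if ∀ i, 0 ≤ a i then
    (Nat.card {f : Fin n → Fin n //
      f ∘ g = f ∧ ∀ i : Fin n, Nat.card {x : Fin n // f x = i} = (a i).toNat} : ℤ)
  else 0

/-- The irreducible character of the symmetric group `S_n` attached to a partition `l`
of `n`, given by the Jacobi–Trudi determinantal formula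
`χ_l = det (h_{l_i - i + j})` expanded over permutations, where `h`-products are the
permutation characters of Young subgroups. (When `size l ≠ n` this is not used.) -/
noncomputable def irrChar (n : ℕ) (l : Partition') (g : Equiv.Perm (Fin n)) : ℤ :=
  ∑ σ : Equiv.Perm (Fin n), (Equiv.Perm.sign σ : ℤ) *
    youngCount n (fun i => (l.1 i : ℤ) + ((σ i : ℕ) : ℤ) - (i : ℤ)) g

/-- The Kronecker coefficient `g_{λ,μ,ν}`: the multiplicity of the irreducible `S_n`-module
`M_ν` in `M_λ ⊗ M_μ` (for `|λ| = |μ| = |ν| = n`), computed as the scalar product of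
characters `(1/n!) ∑_{g ∈ S_n} χ_λ(g) χ_μ(g) χ_ν(g)`; it is `0` if the sizes differ. -/
noncomputable def kron (l m nu : Partition') : ℕ :=
  if size l = size nu ∧ size m = size nu then
    ((∑ g : Equiv.Perm (Fin (size nu)),
        irrChar (size nu) l g * irrChar (size nu) m g * irrChar (size nu) nu g) /
      (Nat.factorial (size nu) : ℤ)).toNat
  else 0

/-- The standard embedding `S_a × S_b ↪ S_{a+b}`. -/
def sumEmb {a b : ℕ} (g : Equiv.Perm (Fin a)) (h : Equiv.Perm (Fin b)) :
    Equiv.Perm (Fin (a + b)) :=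
  (Equiv.permCongr finSumFinEquiv) (Equiv.sumCongr g h)

/-- The Littlewood–Richardson coefficient `c_{λ,μ}^ν`: the multiplicity of `M_ν` in the
induction of `M_λ ⊠ M_μ` from `S_{|λ|} × S_{|μ|}` to `S_{|λ|+|μ|}`, computed by
Frobenius reciprocity as a scalar product of characters; it is `0` unless
`|ν| = |λ| + |μ|`. -/
noncomputable def lr (l m nu : Partition') : ℕ :=
  if size nu = size l + size m then
    ((∑ g : Equiv.Perm (Fin (size l)), ∑ h : Equiv.Perm (Fin (size m)),
        irrChar (size l) l g * irrChar (size m) m h *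
          irrChar (size l + size m) nu (sumEmb g h)) /
      ((Nat.factorial (size l) : ℤ) * (Nat.factorial (size m) : ℤ))).toNat
  else 0

/-- The Aguiar coefficient `a_{λ,μ}^ν`, defined by
`a_{λ,μ}^ν = Σ_{α,β,δ,η,ρ,τ} c_{α,β}^λ c_{η,ρ}^μ g_{β,η,δ} c_{α,δ}^τ c_{τ,ρ}^ν`. -/
noncomputable def aguiar (l m nu : Partition') : ℕ :=
  ∑ᶠ (α : Partition') (β : Partition') (δ : Partition') (η : Partition')
    (ρ : Partition') (τ : Partition'),
    lr α β l * lr η ρ m * kron β η δ * lr α δ τ * lr τ ρ nu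

end Partition'

namespace Partition'

/-- The multiplicity of the irreducible `S_{|ν|}`-module `M_ν` in the Heisenberg product
`M_λ ♯ M_μ`, i.e. in `(M_λ ♯ M_μ)_i` for `i = |ν|`, where `(M_λ ♯ M_μ)_i` is the
induction to `S_i` of the restriction of `M_λ ⊗ M_μ` along the embedding
`S_{i-l} × S_{k+l-i} × S_{i-k} ↪ S_k × S_l` (diagonal on the middle factor). By Frobenius
reciprocity it is the scalar product, over the subgroup
`H = S_{i-l} × S_{k+l-i} × S_{i-k}`, of the restriction of `χ_λ ⊠ χ_μ` along the top
embedding with the restriction of `χ_ν` along the bottom embedding `H ↪ S_i`. It is `0`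
when `i = |ν|` does not lie in `[max(k,l), k+l]`. -/
noncomputable def heisMult (l m nu : Partition') : ℕ :=
  if h : size m ≤ size nu ∧ size l ≤ size nu ∧ size nu ≤ size l + size m then
    ((∑ g : Equiv.Perm (Fin (size nu - size m)),
      ∑ u : Equiv.Perm (Fin (size l + size m - size nu)),
      ∑ w : Equiv.Perm (Fin (size nu - size l)),
        irrChar (size l) l ((finCongr (by omega)).permCongr (sumEmb g u)) *
        irrChar (size m) m ((finCongr (by omega)).permCongr (sumEmb u w)) *
        irrChar (size nu) nu ((finCongr (by omega)).permCongr (sumEmb (sumEmb g u) w))) /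
      ((Nat.factorial (size nu - size m) : ℤ) *
        (Nat.factorial (size l + size m - size nu) : ℤ) *
        (Nat.factorial (size nu - size l) : ℤ))).toNat
  else 0

end Partition'

namespace HeisProof
open MvPolynomial Finset

/-- power sum product, as a sum over functions constant on cycles. -/
noncomputable def pw {n : ℕ} {ι R : Type} [Fintype ι] [CommRing R] (z : ι → R)
    (g : Equiv.Perm (Fin n)) : R :=
  ∑ F : Fin n → ι, if F ∘ g = F then ∏ k, z (F k) else 0

theorem pw_mul {n : ℕ} {ι κ R : Type} [Fintype ι] [Fintype κ] [CommRing R] (x : ι → R) (y : κ → R)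
    (g : Equiv.Perm (Fin n)) :
    pw x g * pw y g = pw (fun p : ι × κ => x p.1 * y p.2) g := by
  unfold pw
  rw [Finset.sum_mul_sum, ← Finset.sum_product']
  refine Fintype.sum_equiv (Equiv.arrowProdEquivProdArrow (Fin n) (fun _ => ι) (fun _ => κ)).symm _ _ ?_
  rintro ⟨F, G⟩
  have h : ((Equiv.arrowProdEquivProdArrow (Fin n) (fun _ => ι) (fun _ => κ)).symm (F, G)) = fun k => (F k, G k) := rfl
  simp only [h]
  have : ((fun k => (F k, G k)) ∘ g = fun k => (F k, G k)) ↔ (F ∘ g = F ∧ G ∘ g = G) := by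
    simp [funext_iff, forall_and]
  by_cases h1 : F ∘ g = F <;> by_cases h2 : G ∘ g = G <;> simp [this, h1, h2, Finset.prod_mul_distrib]

theorem pw_one {n : ℕ} {ι R : Type} [Fintype ι] [CommRing R] (z : ι → R) :
    pw z (1 : Equiv.Perm (Fin n)) = (∑ i, z i) ^ n := by
  unfold pw
  simp only [Equiv.Perm.coe_one, Function.comp_id, if_true]
  simpa using (Fintype.sum_pow z n).symm

theorem pw_map {n : ℕ} {ι R S : Type} [Fintype ι] [CommRing R] [CommRing S] (f : R →+* S) (z : ι → R)
    (g : Equiv.Perm (Fin n)) : f (pw z g) = pw (fun i => f (z i)) g := by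
  unfold pw
  rw [map_sum]
  refine Finset.sum_congr rfl fun F _ => ?_
  split_ifs <;> simp

/-- fibre counts -/
noncomputable def cnt {n : ℕ} {ι : Type} [Fintype ι] (F : Fin n → ι) : ι →₀ ℕ :=
  Finsupp.equivFunOnFinite.symm fun i => Nat.card {x : Fin n // F x = i}

theorem cnt_apply {n : ℕ} {ι : Type} [Fintype ι] (F : Fin n → ι) (i : ι) :
    cnt F i = Nat.card {x : Fin n // F x = i} := rfl

theorem prod_cnt {n : ℕ} {ι R : Type} [Fintype ι] [CommRing R] (z : ι → R) (F : Fin n → ι) :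
    ∏ k, z (F k) = ∏ i, z i ^ cnt F i := by
  rw [Finset.prod_comp z F]
  refine Finset.prod_subset_one_on_sdiff (Finset.subset_univ _) ?_ ?_
  · intro i hi
    have : IsEmpty {x : Fin n // F x = i} := ⟨fun x => by
      simp at hi
      exact hi x.1 x.2⟩
    rw [cnt_apply, Nat.card_of_isEmpty, pow_zero]
  · intro i _
    rw [cnt_apply, Nat.card_eq_fintype_card, Fintype.card_subtype]

theorem cnt_mem {n : ℕ} {ι : Type} [Fintype ι] [DecidableEq ι] (F : Fin n → ι) :
    cnt F ∈ Finset.finsuppAntidiag (Finset.univ : Finset ι) n := by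
  rw [Finset.mem_finsuppAntidiag]
  refine ⟨?_, Finset.subset_univ _⟩
  change ∑ i, cnt F i = n
  simp only [cnt_apply, Nat.card_eq_fintype_card]
  rw [← Fintype.card_sigma, Fintype.card_congr (Equiv.sigmaFiberEquiv F), Fintype.card_fin]

theorem exists_cnt {n : ℕ} {ι : Type} [Fintype ι] [DecidableEq ι] (k : ι →₀ ℕ)
    (hk : k ∈ Finset.finsuppAntidiag (Finset.univ : Finset ι) n) : ∃ F : Fin n → ι, cnt F = k := by
  rw [Finset.mem_finsuppAntidiag] at hk
  have : Fintype.card (Fin n) = Fintype.card (Σ i : ι, Fin (k i)) := by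
    simp [Fintype.card_sigma, hk.1]
  let e := Fintype.equivOfCardEq this
  refine ⟨fun x => (e x).1, ?_⟩
  ext i
  rw [cnt_apply]
  have : {x : Fin n // (e x).1 = i} ≃ Fin (k i) :=
    (e.subtypeEquiv (q := fun y => y.1 = i) (fun x => Iff.rfl)).trans (Equiv.sigmaSubtype i)
  rw [Nat.card_congr this, Nat.card_fin]

theorem exists_perm_of_cnt {n : ℕ} {ι : Type} [Fintype ι] (F F' : Fin n → ι) (h : cnt F = cnt F') :
    ∃ g : Equiv.Perm (Fin n), F ∘ g = F' := by
  have h' : ∀ i, Nonempty ({x : Fin n // F' x = i} ≃ {x : Fin n // F x = i}) := by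
    intro i
    have := DFunLike.congr_fun h i
    rw [cnt_apply, cnt_apply] at this
    exact Finite.card_eq.mp this.symm
  let e := fun i => (h' i).some
  refine ⟨((Equiv.sigmaFiberEquiv F').symm.trans (Equiv.sigmaCongrRight e)).trans (Equiv.sigmaFiberEquiv F), ?_⟩
  ext x
  simp [Equiv.sigmaFiberEquiv]
  exact (e (F' x) ⟨x, rfl⟩).2

theorem cnt_comp {n : ℕ} {ι : Type} [Fintype ι] (F : Fin n → ι) (g : Equiv.Perm (Fin n)) :
    cnt (F ∘ g) = cnt F := by
  ext i
  rw [cnt_apply, cnt_apply]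
  exact Nat.card_congr (g.subtypeEquiv (fun x => Iff.rfl))

theorem sum_stab {n : ℕ} {ι : Type} [Fintype ι] [DecidableEq ι] (k : ι →₀ ℕ)
    (hk : k ∈ Finset.finsuppAntidiag (Finset.univ : Finset ι) n) :
    ∑ F : Fin n → ι with cnt F = k, (#{g : Equiv.Perm (Fin n) | F ∘ g = F}) = n.factorial := by
  obtain ⟨F0, rfl⟩ := exists_cnt k hk
  have h1 : ∀ F ∈ (Finset.univ.filter fun F : Fin n → ι => cnt F = cnt F0),
      #{g : Equiv.Perm (Fin n) | F ∘ g = F} = #{g : Equiv.Perm (Fin n) | F0 ∘ g = F} := by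
    intro F hF
    simp only [Finset.mem_filter, Finset.mem_univ, true_and] at hF
    obtain ⟨g0, hg0⟩ := exists_perm_of_cnt F0 F hF.symm
    refine Finset.card_bij' (fun g _ => g0 * g) (fun g _ => g0⁻¹ * g) ?_ ?_ ?_ ?_
    · intro g hg
      simp only [Finset.mem_filter, Finset.mem_univ, true_and] at hg ⊢
      rw [Equiv.Perm.coe_mul, ← Function.comp_assoc, hg0, hg]
    · intro g hg
      simp only [Finset.mem_filter, Finset.mem_univ, true_and] at hg ⊢
      rw [← hg0, Equiv.Perm.coe_mul, Function.comp_assoc, ← Function.comp_assoc g0, ← Equiv.Perm.coe_mul]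
      simpa [hg0] using hg
    · simp
    · simp
  rw [Finset.sum_congr rfl h1]
  have := Finset.card_eq_sum_card_fiberwise (s := (Finset.univ : Finset (Equiv.Perm (Fin n))))
    (t := (Finset.univ.filter fun F : Fin n → ι => cnt F = cnt F0)) (f := fun g : Equiv.Perm (Fin n) => F0 ∘ g)
    (by intro g _; simp [cnt_comp])
  rw [← this, Finset.card_univ, Fintype.card_perm, Fintype.card_fin]

theorem sum_pw {n : ℕ} {ι R : Type} [Fintype ι] [DecidableEq ι] [CommRing R] (z : ι → R) :
    ∑ g : Equiv.Perm (Fin n), pw z g =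
      n.factorial * ∑ k ∈ Finset.finsuppAntidiag (Finset.univ : Finset ι) n, ∏ i, z i ^ k i := by
  unfold pw
  rw [Finset.sum_comm]
  simp_rw [prod_cnt, ← Finset.sum_filter, Finset.sum_const, nsmul_eq_mul]
  rw [← Finset.sum_fiberwise_of_maps_to (g := cnt) (t := Finset.finsuppAntidiag (Finset.univ : Finset ι) n)
    (fun F _ => cnt_mem F), Finset.mul_sum]
  refine Finset.sum_congr rfl fun k hk => ?_
  rw [← sum_stab k hk, Nat.cast_sum, Finset.sum_mul]
  refine Finset.sum_congr rfl fun F hF => ?_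
  simp only [Finset.mem_filter] at hF
  rw [hF.2]

theorem coeff_pw {n : ℕ} (a : Fin n →₀ ℕ) (g : Equiv.Perm (Fin n)) :
    coeff a (pw (fun i => (X i : MvPolynomial (Fin n) ℤ)) g) =
      (Nat.card {f : Fin n → Fin n // f ∘ g = f ∧ ∀ i, Nat.card {x : Fin n // f x = i} = a i} : ℤ) := by
  unfold pw
  rw [MvPolynomial.coeff_sum, Nat.card_eq_fintype_card, Fintype.card_subtype, Finset.card_filter, Nat.cast_sum]
  refine Finset.sum_congr rfl fun F _ => ?_
  by_cases h : F ∘ g = F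
  · simp only [h, if_true, true_and]
    rw [prod_cnt, MvPolynomial.coeff_prod_X_pow]
    have : (a = Finsupp.indicator Finset.univ fun i _ => cnt F i) ↔ ∀ i, Nat.card {x : Fin n // F x = i} = a i := by
      simp [Finsupp.ext_iff, cnt_apply, eq_comm]
    simp [this]
  · simp [h]

end HeisProof

namespace HeisProof
open Finset

theorem cauchy_field {K : Type} [Field K] {n : ℕ} (u v : Fin n → K) (h0 : ∀ i, v i ≠ 0)
    (hinj : Function.Injective v) :
    Matrix.det (Matrix.of fun i j => ∏ k ∈ ({j}ᶜ : Finset (Fin n)), (1 - v k * u i)) =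
      (Matrix.vandermonde u).det * (Matrix.vandermonde v).det := by
  let P : Fin n → Polynomial K := fun j => ∏ k ∈ ({j}ᶜ : Finset (Fin n)),
    (1 - Polynomial.C (v k) * Polynomial.X)
  have hdeg : ∀ j, (P j).natDegree < n := by
    intro j
    have h1 : (P j).natDegree ≤ ∑ k ∈ ({j}ᶜ : Finset (Fin n)), 1 := by
      refine (Polynomial.natDegree_prod_le _ _).trans (Finset.sum_le_sum fun k _ => ?_)
      compute_degree
    have h2 : #({j}ᶜ : Finset (Fin n)) = n - 1 := by
      rw [Finset.card_compl]; simp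
    have := j.pos
    simp only [Finset.sum_const, h2, smul_eq_mul] at h1
    omega
  let C : Matrix (Fin n) (Fin n) K := Matrix.of fun m j => (P j).coeff m
  have hmul : ∀ w : Fin n → K, Matrix.vandermonde w * C = Matrix.of fun i j => (P j).eval (w i) := by
    intro w
    ext i j
    rw [Matrix.mul_apply, Matrix.of_apply, Polynomial.eval_eq_sum_range' (hdeg j), Finset.sum_range]
    refine Finset.sum_congr rfl fun m _ => ?_
    rw [Matrix.vandermonde_apply, mul_comm]
    rfl
  have heval : ∀ w j, (P j).eval w = ∏ k ∈ ({j}ᶜ : Finset (Fin n)), (1 - v k * w) := by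
    intro w j
    simp [P, Polynomial.eval_prod]
  have hC : C.det = (Matrix.vandermonde v).det := by
    have h1 := congrArg Matrix.det (hmul (fun i => (v i)⁻¹))
    have h2 : (Matrix.of fun i j => (P j).eval ((v i)⁻¹)) =
        Matrix.diagonal fun i => ∏ k ∈ ({i}ᶜ : Finset (Fin n)), (1 - v k * (v i)⁻¹) := by
      ext i j
      rw [Matrix.of_apply, heval]
      by_cases hij : i = j
      · subst hij; simp
      · rw [Matrix.diagonal_apply_ne _ hij]
        apply Finset.prod_eq_zero (i := i)
        · simpa using hij
        · rw [mul_inv_cancel₀ (h0 i), sub_self]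
    rw [h2, Matrix.det_mul, Matrix.det_diagonal] at h1
    have h3 : (Matrix.vandermonde fun i => (v i)⁻¹).det ≠ 0 := by
      rw [Matrix.det_vandermonde_ne_zero_iff]
      intro i j h
      exact hinj (inv_injective h)
    apply mul_left_cancel₀ h3
    rw [h1, Matrix.det_vandermonde, Matrix.det_vandermonde,
      ← Finset.prod_prod_Ioi_mul_eq_prod_prod_off_diag (fun k i => 1 - v k * (v i)⁻¹),
      ← Finset.prod_mul_distrib]
    refine Finset.prod_congr rfl fun i _ => ?_
    rw [← Finset.prod_mul_distrib]
    refine Finset.prod_congr rfl fun j _ => ?_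
    have := h0 i
    have := h0 j
    field_simp
  rw [← hC, ← Matrix.det_mul, hmul]
  simp only [heval]

theorem cauchy_domain {D : Type} [CommRing D] [IsDomain D] {n : ℕ} (u v : Fin n → D)
    (h0 : ∀ i, v i ≠ 0) (hinj : Function.Injective v) (A : Fin n → Fin n → D)
    (hA : ∀ i j, A i j * (1 - v j * u i) = 1) :
    Matrix.det (Matrix.of A) =
      (Matrix.vandermonde u).det * (Matrix.vandermonde v).det * ∏ i, ∏ j, A i j := by
  have h1 : Matrix.det (Matrix.of fun i j => ∏ k ∈ ({j}ᶜ : Finset (Fin n)), (1 - v k * u i)) =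
      (Matrix.vandermonde u).det * (Matrix.vandermonde v).det := by
    let f := algebraMap D (FractionRing D)
    have hf : Function.Injective f := IsFractionRing.injective D (FractionRing D)
    apply hf
    have h := cauchy_field (fun i => f (u i)) (fun i => f (v i))
      (fun i => by simpa using (map_ne_zero_iff f hf).2 (h0 i)) (hf.comp hinj)
    have hv : ∀ w : Fin n → D, f (Matrix.vandermonde w).det = (Matrix.vandermonde fun i => f (w i)).det := by
      intro w
      rw [RingHom.map_det]
      congr 1
      ext i j
      simp [Matrix.vandermonde_apply]
    rw [map_mul, hv, hv, ← h, RingHom.map_det]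
    congr 1
    ext i j
    simp
  rw [← h1, ← Finset.prod_comm, mul_comm]
  have h2 : (Matrix.of fun i j => ∏ k ∈ ({j}ᶜ : Finset (Fin n)), (1 - v k * u i)) =
      Matrix.of fun i j => (∏ k, (1 - v k * u i)) * A i j := by
    ext i j
    simp only [Matrix.of_apply]
    rw [← Finset.prod_compl_mul_prod {j}, Finset.prod_singleton, mul_assoc, mul_comm (1 - v j * u i), hA, mul_one]
  have h3 := Matrix.det_mul_column (fun i => ∏ k, (1 - v k * u i)) (Matrix.of A)
  simp only [Matrix.of_apply] at h3
  rw [h2, h3, ← mul_assoc, Finset.prod_comm (f := fun x y => A y x), ← Finset.prod_mul_distrib]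
  simp_rw [← Finset.prod_mul_distrib, hA]
  simp

end HeisProof

namespace HeisProof
open Finset Partition'

/-- the double polynomial ring -/
abbrev R2 (n : ℕ) : Type := MvPolynomial (Fin n) (MvPolynomial (Fin n) ℤ)

noncomputable def xv {n : ℕ} (i : Fin n) : R2 n := MvPolynomial.X i
noncomputable def yv {n : ℕ} (i : Fin n) : R2 n := MvPolynomial.C (MvPolynomial.X i)

theorem cauchy_coeff (n : ℕ) :
    PowerSeries.coeff ((∑ i : Fin n, (i : ℕ)) + n)
      (Matrix.det (Matrix.of fun i j : Fin n => PowerSeries.mk fun k => (xv i * yv j : R2 n) ^ k)) =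
    (Matrix.vandermonde (xv (n := n))).det * (Matrix.vandermonde (yv (n := n))).det *
      ∑ k ∈ Finset.finsuppAntidiag (Finset.univ : Finset (Fin n × Fin n)) n,
        ∏ p, (xv p.1 * yv p.2 : R2 n) ^ k p := by
  have hy : ∀ j : Fin n, (yv j : R2 n) ≠ 0 := fun j => by simp [yv]
  have hyi : Function.Injective (yv (n := n)) := by
    intro i j h
    simpa [yv] using h
  rw [cauchy_domain (fun i => PowerSeries.C (xv i : R2 n)) (fun j => PowerSeries.X * PowerSeries.C (yv j : R2 n))]
  · have h1 : (Matrix.vandermonde fun i => PowerSeries.C (xv i : R2 n)).det =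
        PowerSeries.C (Matrix.vandermonde (xv (n := n))).det := by
      rw [RingHom.map_det]
      congr 1
      ext1 i j
      simp [Matrix.vandermonde_apply]
    have h2 : (Matrix.vandermonde fun i => PowerSeries.X * PowerSeries.C (yv i : R2 n)).det =
        PowerSeries.X ^ (∑ i : Fin n, (i : ℕ)) * PowerSeries.C (Matrix.vandermonde (yv (n := n))).det := by
      rw [RingHom.map_det, ← Finset.prod_pow_eq_pow_sum, ← Matrix.det_mul_row]
      congr 1
      ext1 i j
      simp [Matrix.vandermonde_apply, mul_pow]
    rw [h1, h2, ← Fintype.prod_prod_type']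
    rw [show ∀ (a b c d : PowerSeries (R2 n)), a * (b * c) * d = (a * c * d) * b from fun a b c d => by ring]
    rw [add_comm, PowerSeries.coeff_mul_X_pow, ← map_mul, PowerSeries.coeff_C_mul, PowerSeries.coeff_prod]
    simp [PowerSeries.coeff_mk]
  · intro i
    exact mul_ne_zero PowerSeries.X_ne_zero ((map_ne_zero_iff _ PowerSeries.C_injective).2 (hy i))
  · intro i j h
    have := mul_left_cancel₀ PowerSeries.X_ne_zero h
    exact hyi (PowerSeries.C_injective this)
  · intro i j
    have h := PowerSeries.mk_one_mul_one_sub_eq_one (R2 n)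
    have := congrArg (PowerSeries.rescale (xv i * yv j : R2 n)) h
    simp only [map_mul, map_sub, map_one, PowerSeries.rescale_X] at this
    have h1 : PowerSeries.rescale (xv i * yv j : R2 n) (PowerSeries.mk 1) =
        PowerSeries.mk fun k => (xv i * yv j : R2 n) ^ k := by
      ext1 k
      rw [PowerSeries.coeff_rescale, PowerSeries.coeff_mk, PowerSeries.coeff_mk, Pi.one_apply, mul_one]
    have h2 : PowerSeries.X * PowerSeries.C (yv j : R2 n) * PowerSeries.C (xv i : R2 n) =
        PowerSeries.C (xv i : R2 n) * PowerSeries.C (yv j : R2 n) * PowerSeries.X := by ring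
    rw [h1] at this
    rw [h2, this]

noncomputable def fs {n : ℕ} (a : Fin n → ℕ) : Fin n →₀ ℕ := Finsupp.equivFunOnFinite.symm a

@[simp] theorem fs_apply {n : ℕ} (a : Fin n → ℕ) (i : Fin n) : fs a i = a i := rfl

/-- double coefficient extraction -/
noncomputable def co {n : ℕ} (a b : Fin n → ℕ) : R2 n →+ ℤ :=
  (MvPolynomial.coeffAddMonoidHom (fs b)).comp (MvPolynomial.coeffAddMonoidHom (fs a))

theorem co_apply {n : ℕ} (a b : Fin n → ℕ) (p : R2 n) :
  co a b p = MvPolynomial.coeff (fs b) (MvPolynomial.coeff (fs a) p) := rfl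

theorem co_mul {n : ℕ} (a b : Fin n → ℕ) (p q : MvPolynomial (Fin n) ℤ) :
    co a b (MvPolynomial.map MvPolynomial.C p * MvPolynomial.C q) =
      MvPolynomial.coeff (fs a) p * MvPolynomial.coeff (fs b) q := by
  rw [co_apply, mul_comm, MvPolynomial.coeff_C_mul, mul_comm, MvPolynomial.coeff_map, MvPolynomial.coeff_C_mul]

theorem coeff_prod_perm {n : ℕ} (a k : Fin n → ℕ) (σ : Equiv.Perm (Fin n)) :
    MvPolynomial.coeff (fs a) (∏ i, (MvPolynomial.X (σ i) : MvPolynomial (Fin n) ℤ) ^ k i) =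
      if ∀ i, a (σ i) = k i then 1 else 0 := by
  have : (∏ i, (MvPolynomial.X (σ i) : MvPolynomial (Fin n) ℤ) ^ k i) =
      ∏ i, (MvPolynomial.X i : MvPolynomial (Fin n) ℤ) ^ k (σ.symm i) :=
    Fintype.prod_equiv σ _ _ (fun i => by simp)
  rw [this, MvPolynomial.coeff_prod_X_pow]
  congr 1
  simp only [Finsupp.ext_iff, eq_iff_iff]
  rw [← σ.forall_congr_right]
  simp

theorem perm_eq_one_of_strictMono {n : ℕ} (σ : Equiv.Perm (Fin n)) (h : StrictMono σ) : σ = 1 := by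
  have h2 : (⟨σ, fun {a b} => h.le_iff_le⟩ : Fin n ≃o Fin n) = OrderIso.refl _ := Subsingleton.elim _ _
  ext i
  have := congrArg (fun e : Fin n ≃o Fin n => e i) h2
  simpa using congrArg Fin.val this

theorem co_det {n N : ℕ} (a b : Fin n → ℕ) (ha : StrictAnti a) (hb : StrictAnti b) (hN : ∑ i, b i = N) :
    co a b (PowerSeries.coeff N
      (Matrix.det (Matrix.of fun i j : Fin n => PowerSeries.mk fun k => (xv i * yv j : R2 n) ^ k))) =
      if a = b then 1 else 0 := by
  rw [Matrix.det_apply', map_sum, map_sum]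
  have key : ∀ σ : Equiv.Perm (Fin n), co a b (PowerSeries.coeff N
      (((Equiv.Perm.sign σ : ℤ) : PowerSeries (R2 n)) * ∏ i, (Matrix.of fun i j : Fin n => PowerSeries.mk fun k => (xv i * yv j : R2 n) ^ k) (σ i) i)) =
      if σ = 1 then (if a = b then 1 else 0) else 0 := by
    intro σ
    have h1 : co a b (PowerSeries.coeff N (∏ i, (Matrix.of fun i j : Fin n => PowerSeries.mk fun k => (xv i * yv j : R2 n) ^ k) (σ i) i)) =
        if ∀ i, a (σ i) = b i then 1 else 0 := by
      rw [PowerSeries.coeff_prod, map_sum]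
      simp only [Matrix.of_apply, PowerSeries.coeff_mk]
      have h2 : ∀ k : Fin n →₀ ℕ, co a b (∏ i, (xv (σ i) * yv i : R2 n) ^ k i) =
          (if ∀ i, a (σ i) = k i then 1 else 0) * (if fs b = k then 1 else 0) := by
        intro k
        have : (∏ i, (xv (σ i) * yv i : R2 n) ^ k i) =
          MvPolynomial.map MvPolynomial.C (∏ i, (MvPolynomial.X (σ i) : MvPolynomial (Fin n) ℤ) ^ k i) *
          MvPolynomial.C (∏ i, (MvPolynomial.X ((1 : Equiv.Perm (Fin n)) i) : MvPolynomial (Fin n) ℤ) ^ k i) := by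
          simp [mul_pow, Finset.prod_mul_distrib, xv, yv]
        rw [this, co_mul, coeff_prod_perm, coeff_prod_perm]
        congr 2
        simp [Finsupp.ext_iff]
      simp_rw [h2, mul_ite, mul_one, mul_zero]
      rw [Finset.sum_ite_eq, if_pos]
      · rfl
      · rw [Finset.mem_finsuppAntidiag]
        exact ⟨hN, Finset.subset_univ _⟩
    rw [← zsmul_eq_mul, map_zsmul, map_zsmul, h1]
    by_cases hσ : σ = 1
    · subst hσ
      have : a = b ↔ ∀ i, a ((1 : Equiv.Perm (Fin n)) i) = b i := by simp [funext_iff]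
      simp only [this, if_true, Equiv.Perm.sign_one, Units.val_one, one_smul]
    · rw [if_neg hσ, if_neg, smul_zero]
      intro h
      apply hσ
      apply perm_eq_one_of_strictMono
      intro i j hij
      rw [← ha.lt_iff_gt, h, h]
      exact hb hij
  simp_rw [key]
  simp

/-- exponent vector `λ + δ` -/
def lam (n : ℕ) (l : Partition') (i : Fin n) : ℕ := l.1 i + (n - 1 - i)

theorem lam_strictAnti (n : ℕ) (l : Partition') : StrictAnti (lam n l) := by
  intro i j hij
  have h1 : l.1 j ≤ l.1 i := l.2 (by exact_mod_cast hij.le)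
  have : (i : ℕ) < j := hij
  have := j.2
  unfold lam
  omega

theorem size_eq_sum {l : Partition'} {n : ℕ} (h : ∀ i, n ≤ i → l.1 i = 0) : size l = ∑ i : Fin n, l.1 i := by
  unfold size
  rw [Finsupp.sum_of_support_subset (s := Finset.range n), Finset.sum_range]
  · intro i hi
    simp at hi ⊢
    by_contra hc
    exact hi (h i (by omega))
  · simp

theorem part_zero (l : Partition') : ∀ i, size l ≤ i → l.1 i = 0 := by
  intro i hi
  by_contra hc
  have h1 : (Finset.range (i+1)).sum l.1 ≤ size l := by
    unfold size
    rw [Finsupp.sum]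
    rw [← Finset.sum_filter_ne_zero]
    apply Finset.sum_le_sum_of_subset
    intro j hj
    simp at hj ⊢
    exact hj.2
  have h2 : ∑ j ∈ Finset.range (i+1), 1 ≤ (Finset.range (i+1)).sum l.1 := by
    apply Finset.sum_le_sum
    intro j hj
    have := l.2 (show j ≤ i by simp at hj; omega)
    omega
  simp at h2
  omega

theorem lam_inj {n : ℕ} {l m : Partition'} (hl : size l = n) (hm : size m = n) :
    lam n l = lam n m ↔ l = m := by
  constructor
  · intro h
    apply Subtype.ext
    ext i
    by_cases hi : i < n
    · have := congrFun h ⟨i, hi⟩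
      simp only [lam] at this
      omega
    · rw [part_zero l i (by omega), part_zero m i (by omega)]
  · rintro rfl; rfl

theorem sum_lam {n : ℕ} {l : Partition'} (hl : size l = n) : ∑ i, lam n l i = (∑ i : Fin n, (i : ℕ)) + n := by
  unfold lam
  rw [Finset.sum_add_distrib, ← size_eq_sum (fun i hi => part_zero l i (by omega)), hl, add_comm]
  congr 1
  refine Fintype.sum_equiv Fin.revPerm _ _ fun i => ?_
  simp [Fin.val_rev]
  omega

/-- Vandermonde -/
noncomputable def vd (n : ℕ) : MvPolynomial (Fin n) ℤ :=
  Matrix.det (Matrix.of fun i j : Fin n => (MvPolynomial.X j : MvPolynomial (Fin n) ℤ) ^ (n - 1 - (i : ℕ)))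

theorem vd_eq (n : ℕ) : vd n = ((Equiv.Perm.sign (Fin.revPerm (n := n)) : ℤ) : MvPolynomial (Fin n) ℤ) *
    (Matrix.vandermonde fun i : Fin n => (MvPolynomial.X i : MvPolynomial (Fin n) ℤ)).det := by
  rw [← Matrix.det_permute', vd, ← Matrix.det_transpose]
  congr 1
  ext1 i j
  simp [Matrix.vandermonde_apply, Fin.val_rev]
  congr 1
  omega

theorem frobenius (n : ℕ) (l : Partition') (g : Equiv.Perm (Fin n)) :
    irrChar n l g = MvPolynomial.coeff (fs (lam n l))
      (vd n * pw (fun i => (MvPolynomial.X i : MvPolynomial (Fin n) ℤ)) g) := by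
  unfold irrChar vd
  rw [Matrix.det_apply', Finset.sum_mul, MvPolynomial.coeff_sum]
  refine Finset.sum_congr rfl fun σ _ => ?_
  have h1 : (∏ i, Matrix.of (fun i j : Fin n => (MvPolynomial.X j : MvPolynomial (Fin n) ℤ) ^ (n - 1 - (i : ℕ))) (σ i) i) =
      MvPolynomial.monomial (fs fun i => n - 1 - (σ i : ℕ)) 1 := by
    simp only [Matrix.of_apply]
    rw [MvPolynomial.monomial_eq, Finsupp.prod_fintype]
    · simp
    · simp
  rw [mul_assoc, ← zsmul_eq_mul, MvPolynomial.coeff_smul, h1, MvPolynomial.coeff_monomial_mul', smul_eq_mul]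
  congr 1
  unfold youngCount
  have h2 : (∀ i : Fin n, 0 ≤ (l.1 i : ℤ) + ((σ i : ℕ) : ℤ) - (i : ℤ)) ↔
      (fs fun i => n - 1 - (σ i : ℕ)) ≤ fs (lam n l) := by
    rw [Finsupp.le_def]
    refine forall_congr' fun i => ?_
    simp only [fs_apply, lam]
    have := i.2
    have := (σ i).2
    omega
  by_cases h : (fs fun i => n - 1 - (σ i : ℕ)) ≤ fs (lam n l)
  · rw [if_pos (h2.2 h), if_pos h, one_mul, coeff_pw]
    have h3 : ∀ i : Fin n, ((l.1 i : ℤ) + ((σ i : ℕ) : ℤ) - (i : ℤ)).toNat =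
        (fs (lam n l) - fs fun i => n - 1 - (σ i : ℕ)) i := by
      intro i
      simp only [Finsupp.tsub_apply, fs_apply, lam]
      have := i.2
      have := (σ i).2
      omega
    simp only [h3]
  · rw [if_neg (fun hc => h (h2.1 hc)), if_neg h]

theorem vd_prod (n : ℕ) :
    MvPolynomial.map MvPolynomial.C (vd n) * MvPolynomial.C (vd n) =
    (Matrix.vandermonde (xv (n := n))).det * (Matrix.vandermonde (yv (n := n))).det := by
  have h1 : MvPolynomial.map MvPolynomial.C (Matrix.vandermonde fun i : Fin n => (MvPolynomial.X i : MvPolynomial (Fin n) ℤ)).det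
      = (Matrix.vandermonde (xv (n := n))).det := by
    rw [RingHom.map_det]
    congr 1
    ext1 i j
    simp [Matrix.vandermonde_apply, xv]
  have h2 : MvPolynomial.C (Matrix.vandermonde fun i : Fin n => (MvPolynomial.X i : MvPolynomial (Fin n) ℤ)).det
      = (Matrix.vandermonde (yv (n := n))).det := by
    rw [RingHom.map_det]
    congr 1
    ext1 i j
    simp [Matrix.vandermonde_apply, yv]
  rw [vd_eq, map_mul, map_mul, h1, h2, map_intCast, map_intCast]
  rw [show ∀ e a b : R2 n, (e * a) * (e * b) = (e * e) * (a * b) from fun e a b => by ring]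
  rw [← Int.cast_mul, ← Units.val_mul, Int.units_mul_self]
  simp

theorem orth (n : ℕ) (l m : Partition') (hl : size l = n) (hm : size m = n) :
    ∑ g : Equiv.Perm (Fin n), irrChar n l g * irrChar n m g = if l = m then (n.factorial : ℤ) else 0 := by
  have h1 : ∀ g : Equiv.Perm (Fin n), irrChar n l g * irrChar n m g = co (lam n l) (lam n m)
    ((Matrix.vandermonde (xv (n := n))).det * (Matrix.vandermonde (yv (n := n))).det *
      pw (fun p : Fin n × Fin n => (xv p.1 * yv p.2 : R2 n)) g) := by
    intro g
    rw [frobenius, frobenius, ← co_mul, (MvPolynomial.map MvPolynomial.C).map_mul,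
      MvPolynomial.C.map_mul, pw_map, pw_map, ← vd_prod, ← pw_mul]
    simp only [MvPolynomial.map_X]
    unfold xv yv
    rw [mul_mul_mul_comm]
  simp_rw [h1]
  rw [← map_sum, ← Finset.mul_sum, sum_pw, mul_left_comm, ← nsmul_eq_mul, map_nsmul, ← cauchy_coeff,
    co_det _ _ (lam_strictAnti n l) (lam_strictAnti n m) (sum_lam hm)]
  simp [lam_inj hl hm]

end HeisProof

namespace HeisProof
open Finset Partition'

noncomputable def psum1 (n : ℕ) : MvPolynomial (Fin n) ℤ := ∑ i, MvPolynomial.X i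

theorem vd_rename {n : ℕ} (i j : Fin n) (hij : i ≠ j) :
    MvPolynomial.rename (Equiv.swap i j) (vd n) = - vd n := by
  have h : MvPolynomial.rename (Equiv.swap i j) (vd n) = Matrix.det ((Matrix.of fun i j : Fin n =>
      (MvPolynomial.X j : MvPolynomial (Fin n) ℤ) ^ (n - 1 - (i : ℕ))).submatrix id (Equiv.swap i j)) := by
    unfold vd
    rw [AlgHom.map_det]
    congr 1
    ext1 a b
    simp
  rw [h, Matrix.det_permute', Equiv.Perm.sign_swap hij]
  simp [vd]

theorem vdp_rename {n : ℕ} (k : ℕ) (i j : Fin n) (hij : i ≠ j) :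
    MvPolynomial.rename (Equiv.swap i j) (vd n * psum1 n ^ k) = - (vd n * psum1 n ^ k) := by
  rw [map_mul, vd_rename i j hij, map_pow]
  have : MvPolynomial.rename (Equiv.swap i j) (psum1 n) = psum1 n := by
    unfold psum1
    rw [map_sum]
    exact Fintype.sum_equiv (Equiv.swap i j) _ _ (fun x => by simp)
  rw [this, neg_mul]

theorem vdp_coeff_zero {n : ℕ} (k : ℕ) (a : Fin n →₀ ℕ) (i j : Fin n) (hij : i ≠ j) (h : a i = a j) :
    MvPolynomial.coeff a (vd n * psum1 n ^ k) = 0 := by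
  have h1 := MvPolynomial.coeff_rename_mapDomain (Equiv.swap i j) (Equiv.injective _)
    (vd n * psum1 n ^ k) a
  have h2 : Finsupp.mapDomain (Equiv.swap i j) a = a := by
    ext x
    rw [Finsupp.mapDomain_equiv_apply, Equiv.symm_swap]
    by_cases hxi : x = i
    · subst hxi; simp [h]
    by_cases hxj : x = j
    · subst hxj; simp [h]
    rw [Equiv.swap_apply_of_ne_of_ne hxi hxj]
  rw [h2, vdp_rename k i j hij, MvPolynomial.coeff_neg] at h1
  omega

theorem vdp_nonneg {n : ℕ} (k : ℕ) : ∀ a : Fin n →₀ ℕ, StrictAnti a →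
    0 ≤ MvPolynomial.coeff a (vd n * psum1 n ^ k) := by
  induction k with
  | zero =>
    intro a ha
    rw [pow_zero, mul_one, vd, Matrix.det_apply', MvPolynomial.coeff_sum]
    refine Finset.sum_nonneg fun σ _ => ?_
    rw [← zsmul_eq_mul, MvPolynomial.coeff_smul]
    simp only [Matrix.of_apply]
    rw [MvPolynomial.coeff_prod_X_pow]
    split_ifs with h
    · have : σ = 1 := by
        apply perm_eq_one_of_strictMono
        intro i j hij
        have := ha hij
        rw [h] at this
        simp at this
        have h1 := (σ i).2
        have h2 := (σ j).2
        show (σ i : ℕ) < σ j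
        omega
      simp [this]
    · simp
  | succ k ih =>
    intro a ha
    rw [pow_succ, ← mul_assoc]
    nth_rw 2 [psum1]
    rw [Finset.mul_sum, MvPolynomial.coeff_sum]
    refine Finset.sum_nonneg fun i _ => ?_
    rw [MvPolynomial.coeff_mul_X']
    split_ifs with hi
    · by_cases h : StrictAnti (a - Finsupp.single i 1 : Fin n →₀ ℕ)
      · exact ih _ h
      · apply le_of_eq
        symm
        unfold StrictAnti at h
        push Not at h
        obtain ⟨x, y, hxy, h⟩ := h
        have h1 := ha hxy
        simp only [Finsupp.tsub_apply, Finsupp.single_apply] at h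
        refine vdp_coeff_zero k _ x y hxy.ne ?_
        simp only [Finsupp.tsub_apply, Finsupp.single_apply]
        split_ifs at h ⊢ <;> subst_vars <;> omega
    · exact le_rfl

theorem irrChar_one_nonneg (n : ℕ) (l : Partition') : 0 ≤ irrChar n l 1 := by
  rw [frobenius, pw_one]
  exact vdp_nonneg n _ (lam_strictAnti n l)

end HeisProof

namespace HeisProof
open Finset Partition' Representation

theorem trace_sub_quot {V : Type} [AddCommGroup V] [Module ℚ V] [FiniteDimensional ℚ V]
    (f : V →ₗ[ℚ] V) (W : Submodule ℚ V) (h : W ≤ W.comap f) :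
    LinearMap.trace ℚ V f = LinearMap.trace ℚ W (f.restrict h) +
      LinearMap.trace ℚ (V ⧸ W) (W.mapQ W f h) := by
  obtain ⟨s, hs⟩ := W.mkQ.exists_rightInverse_of_surjective W.range_mkQ
  have hmem : ∀ v, (LinearMap.id - s ∘ₗ W.mkQ : V →ₗ[ℚ] V) v ∈ W := by
    intro v
    refine (Submodule.Quotient.mk_eq_zero W).1 ?_
    change W.mkQ _ = 0
    have := LinearMap.congr_fun hs (W.mkQ v)
    simp only [LinearMap.comp_apply, LinearMap.id_apply] at this
    rw [LinearMap.sub_apply, map_sub, LinearMap.comp_apply, this]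
    exact sub_self _
  let p : V →ₗ[ℚ] W := (LinearMap.id - s ∘ₗ W.mkQ : V →ₗ[ℚ] V).codRestrict W hmem
  have hp : W.subtype ∘ₗ p + s ∘ₗ W.mkQ = LinearMap.id := by
    ext v
    simp [p]
  have h1 : p ∘ₗ (f ∘ₗ W.subtype) = f.restrict h := by
    ext v
    have : W.mkQ (f v) = 0 := by
      rw [← LinearMap.mem_ker, Submodule.ker_mkQ]
      exact h v.2
    simp only [Submodule.mkQ_apply] at this
    simp [p, this]
  have h2 : W.mkQ ∘ₗ (f ∘ₗ s) = W.mapQ W f h := by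
    have : W.mkQ ∘ₗ f = W.mapQ W f h ∘ₗ W.mkQ := by
      ext v; simp
    rw [← LinearMap.comp_assoc, this, LinearMap.comp_assoc, hs, LinearMap.comp_id]
  rw [← h1, ← h2, LinearMap.trace_comp_comm' (f ∘ₗ W.subtype) p, LinearMap.trace_comp_comm' (f ∘ₗ s) W.mkQ, ← map_add]
  congr 1
  rw [LinearMap.comp_assoc, LinearMap.comp_assoc, ← LinearMap.comp_add, hp, LinearMap.comp_id]

def IsChar {G : Type} [Group G] (f : G → ℚ) : Prop :=
  ∃ (V : Type) (_ : AddCommGroup V) (_ : Module ℚ V) (_ : FiniteDimensional ℚ V)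
    (ρ : Representation ℚ G V), ρ.character = f

variable {G H : Type} [Group G] [Group H]

theorem IsChar.zero : IsChar (fun _ : G => (0 : ℚ)) :=
  ⟨PUnit, inferInstance, inferInstance, inferInstance, Representation.trivial ℚ G PUnit, by
    ext g
    simp [character]⟩

theorem IsChar.add {f g : G → ℚ} (hf : IsChar f) (hg : IsChar g) : IsChar (fun x => f x + g x) := by
  obtain ⟨V, _, _, _, ρ, rfl⟩ := hf
  obtain ⟨W, _, _, _, σ, rfl⟩ := hg
  refine ⟨V × W, inferInstance, inferInstance, inferInstance, ρ.prod σ, ?_⟩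
  ext x
  exact LinearMap.trace_prodMap' (ρ x) (σ x)

theorem IsChar.mul {f g : G → ℚ} (hf : IsChar f) (hg : IsChar g) : IsChar (fun x => f x * g x) := by
  obtain ⟨V, _, _, _, ρ, rfl⟩ := hf
  obtain ⟨W, _, _, _, σ, rfl⟩ := hg
  exact ⟨TensorProduct ℚ V W, inferInstance, inferInstance, inferInstance, ρ.tprod σ, char_tensor ρ σ⟩

theorem IsChar.comp {f : G → ℚ} (hf : IsChar f) (φ : H →* G) : IsChar (fun x => f (φ x)) := by
  obtain ⟨V, _, _, _, ρ, rfl⟩ := hf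
  exact ⟨V, inferInstance, inferInstance, inferInstance, ρ.comp φ, rfl⟩

theorem IsChar.perm {X : Type} [Fintype X] (T : G → X → X) (h1 : T 1 = id)
    (hm : ∀ g h, T (g * h) = T h ∘ T g) : IsChar (fun g => (Nat.card {x // T g x = x} : ℚ)) := by
  refine ⟨X → ℚ, inferInstance, inferInstance, inferInstance,
    { toFun := fun g => LinearMap.funLeft ℚ ℚ (T g)
      map_one' := by rw [h1]; ext; simp
      map_mul' := fun g h => by rw [hm]; ext; simp [LinearMap.funLeft_apply] }, ?_⟩
  ext g
  change LinearMap.trace ℚ _ (LinearMap.funLeft ℚ ℚ (T g)) = _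
  rw [LinearMap.trace_eq_matrix_trace ℚ (Pi.basisFun ℚ X), Matrix.trace]
  simp only [Matrix.diag_apply, LinearMap.toMatrix_apply, Pi.basisFun_apply, Pi.basisFun_repr,
    LinearMap.funLeft_apply]
  rw [Nat.card_eq_fintype_card, Fintype.card_subtype, Finset.card_filter, Nat.cast_sum]
  refine Finset.sum_congr rfl fun x _ => ?_
  simp [Pi.single_apply]

theorem IsChar.sum_nat [Fintype G] {f : G → ℚ} (hf : IsChar f) :
    ∃ k : ℕ, ∑ g, f g = Fintype.card G * k := by
  obtain ⟨V, _, _, _, ρ, rfl⟩ := hf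
  have h0 : (Nat.card G : ℚ) ≠ 0 := by simp
  haveI : Invertible (Nat.card G : ℚ) := invertibleOfNonzero h0
  refine ⟨Module.finrank ℚ (invariants ρ), ?_⟩
  rw [← card_inv_mul_sum_char_eq_finrank, ← Nat.card_eq_fintype_card, mul_inv_cancel_left₀ h0]

theorem isChar_of_virtual_aux [Fintype G] (N : ℕ) : ∀ (V W : Type) [AddCommGroup V] [Module ℚ V] [FiniteDimensional ℚ V]
    [AddCommGroup W] [Module ℚ W] [FiniteDimensional ℚ W] (ρ : Representation ℚ G V)
    (σ : Representation ℚ G W), Module.finrank ℚ V + Module.finrank ℚ W = N → ∀ f : G → ℚ,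
    (∀ g, f g = ρ.character g - σ.character g) → (∑ g, f g * f g⁻¹ = Fintype.card G) →
    0 ≤ f 1 → IsChar f := by
  induction N using Nat.strong_induction_on with
  | _ N ih =>
  intro V W _ _ _ _ _ _ ρ σ hN f hf hnorm hpos
  have h0 : (Nat.card G : ℚ) ≠ 0 := by simp
  haveI : Invertible (Nat.card G : ℚ) := invertibleOfNonzero h0
  by_cases hT : ∃ T : IntertwiningMap ρ σ, T ≠ 0
  · obtain ⟨T, hT⟩ := hT
    have hk : ∀ g, LinearMap.ker T.toLinearMap ≤ (LinearMap.ker T.toLinearMap).comap (ρ g) := by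
      intro g v hv
      rw [LinearMap.mem_ker] at hv
      rw [Submodule.mem_comap, LinearMap.mem_ker]
      have := IntertwiningMap.isIntertwining ρ σ T g v
      simp only [← IntertwiningMap.toLinearMap_apply] at this
      rw [this, hv, map_zero]
    have hr : ∀ g, LinearMap.range T.toLinearMap ≤ (LinearMap.range T.toLinearMap).comap (σ g) := by
      rintro g _ ⟨v, rfl⟩
      exact ⟨ρ g v, IntertwiningMap.isIntertwining ρ σ T g v⟩
    have e : ∀ g, LinearMap.trace ℚ _ ((LinearMap.ker T.toLinearMap).mapQ _ (ρ g) (hk g)) =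
        LinearMap.trace ℚ _ ((σ g).restrict (hr g)) := by
      intro g
      rw [← LinearMap.trace_conj' _ T.toLinearMap.quotKerEquivRange]
      congr 1
      ext ⟨_, v, rfl⟩
      have h3 : T.toLinearMap.quotKerEquivRange.symm ⟨T.toLinearMap v, v, rfl⟩ =
          (LinearMap.ker T.toLinearMap).mkQ v := by
        rw [LinearEquiv.symm_apply_eq]
        rfl
      rw [LinearEquiv.conj_apply_apply, h3]
      exact IntertwiningMap.isIntertwining ρ σ T g v
    have hrpos : 0 < Module.finrank ℚ (LinearMap.range T.toLinearMap) := by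
      rw [Module.finrank_pos_iff, Submodule.nontrivial_iff_ne_bot, Ne, LinearMap.range_eq_bot]
      intro h
      exact hT (IntertwiningMap.ext h)
    have d1 := LinearMap.finrank_range_add_finrank_ker T.toLinearMap
    have d2 := (LinearMap.range T.toLinearMap).finrank_quotient_add_finrank
    refine ih _ ?_ (LinearMap.ker T.toLinearMap) (W ⧸ LinearMap.range T.toLinearMap)
      (ρ.subrepresentation _ hk) (σ.quotient _ hr) rfl f ?_ hnorm hpos
    · omega
    · intro g
      rw [hf g]
      have t1 := trace_sub_quot (ρ g) _ (hk g)
      have t2 := trace_sub_quot (σ g) _ (hr g)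
      rw [e] at t1
      unfold character
      rw [t1, t2]
      change _ = LinearMap.trace ℚ _ ((ρ g).restrict (hk g)) - LinearMap.trace ℚ _ (Submodule.mapQ _ _ (σ g) (hr g))
      ring
  · push Not at hT
    have hsub : Subsingleton (IntertwiningMap ρ σ) := ⟨fun a b => by rw [hT a, hT b]⟩
    have hsum : ∀ {V W : Type} [AddCommGroup V] [Module ℚ V] [FiniteDimensional ℚ V]
      [AddCommGroup W] [Module ℚ W] [FiniteDimensional ℚ W] (ρ : Representation ℚ G V)
      (σ : Representation ℚ G W), ∑ g, σ.character g * ρ.character g⁻¹ =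
        Nat.card G * Module.finrank ℚ (IntertwiningMap ρ σ) := by
      intro V W _ _ _ _ _ _ ρ σ
      rw [← card_inv_mul_sum_char_mul_char_eq_finrank, mul_inv_cancel_left₀ h0]
    have c1 : ∑ g, σ.character g * ρ.character g⁻¹ = 0 := by
      rw [hsum, Module.finrank_zero_of_subsingleton]; simp
    have c2 : ∑ g, ρ.character g * σ.character g⁻¹ = 0 := by
      rw [← c1]
      refine Fintype.sum_equiv (Equiv.inv G) _ _ fun g => ?_
      simp [mul_comm]
    have c3 : ∑ g, f g * f g⁻¹ = Nat.card G * (Module.finrank ℚ (IntertwiningMap ρ ρ) + Module.finrank ℚ (IntertwiningMap σ σ) : ℚ) := by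
      have : ∑ g, f g * f g⁻¹ = ∑ g, ρ.character g * ρ.character g⁻¹ + ∑ g, σ.character g * σ.character g⁻¹
          - ∑ g, σ.character g * ρ.character g⁻¹ - ∑ g, ρ.character g * σ.character g⁻¹ := by
        rw [← Finset.sum_add_distrib, ← Finset.sum_sub_distrib, ← Finset.sum_sub_distrib]
        refine Finset.sum_congr rfl fun g _ => ?_
        rw [hf, hf]
        ring
      rw [this, c1, c2, hsum, hsum]
      ring
    rw [hnorm, ← Nat.card_eq_fintype_card] at c3
    have c4 : (1 : ℚ) = Module.finrank ℚ (IntertwiningMap ρ ρ) + Module.finrank ℚ (IntertwiningMap σ σ) :=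
      mul_left_cancel₀ h0 (by rw [mul_one]; exact c3)
    have c5 : 1 = Module.finrank ℚ (IntertwiningMap ρ ρ) + Module.finrank ℚ (IntertwiningMap σ σ) := by
      exact_mod_cast c4
    have fin0 : ∀ {V : Type} [AddCommGroup V] [Module ℚ V] [FiniteDimensional ℚ V] (ρ : Representation ℚ G V),
        Module.finrank ℚ (IntertwiningMap ρ ρ) = 0 → Module.finrank ℚ V = 0 := by
      intro V _ _ _ ρ h
      haveI : Module.Finite ℚ (IntertwiningMap ρ ρ) :=
        Module.Finite.equiv (invariantsEquivIntertwiningMap ρ ρ)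
      have hs : Subsingleton (IntertwiningMap ρ ρ) := Module.finrank_zero_iff.1 h
      rw [Module.finrank_zero_iff]
      refine ⟨fun a b => ?_⟩
      have h1 := congrArg IntertwiningMap.toLinearMap (Subsingleton.elim (IntertwiningMap.id ρ) 0)
      have h2 : ∀ v, v = (0 : V) := fun v => by
        have := LinearMap.congr_fun h1 v
        simpa using this
      rw [h2 a, h2 b]
    have h1 := hf 1
    rw [char_one, char_one] at h1
    have hσ0 : Module.finrank ℚ W = 0 := by
      by_cases hρ : Module.finrank ℚ (IntertwiningMap ρ ρ) = 0
      · have := fin0 ρ hρ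
        rw [this] at h1
        have h2 : (Module.finrank ℚ W : ℚ) ≤ 0 := by
          rw [h1] at hpos
          simpa using hpos
        have : Module.finrank ℚ W ≤ 0 := by exact_mod_cast h2
        omega
      · exact fin0 σ (by omega)
    refine ⟨V, inferInstance, inferInstance, inferInstance, ρ, ?_⟩
    ext g
    have : Subsingleton W := Module.finrank_zero_iff.1 hσ0
    rw [hf g]
    have : σ.character g = 0 := by
      unfold character
      rw [Subsingleton.elim (σ g) 0, map_zero]
    rw [this, sub_zero]

def IsVirt (f : G → ℚ) : Prop := ∃ a b : G → ℚ, IsChar a ∧ IsChar b ∧ ∀ g, f g = a g - b g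

theorem IsVirt.isChar [Fintype G] {f : G → ℚ} (hf : IsVirt f)
    (h1 : ∑ g, f g * f g⁻¹ = Fintype.card G) (h2 : 0 ≤ f 1) : IsChar f := by
  obtain ⟨_, _, ⟨V, _, _, _, ρ, rfl⟩, ⟨W, _, _, _, σ, rfl⟩, h⟩ := hf
  exact isChar_of_virtual_aux _ V W ρ σ rfl f h h1 h2

theorem IsVirt.sum {ι : Type} (s : Finset ι) (f : ι → G → ℚ) (h : ∀ i ∈ s, IsVirt (f i)) :
    IsVirt (fun g => ∑ i ∈ s, f i g) := by
  induction s using Finset.induction_on with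
  | empty => exact ⟨_, _, IsChar.zero, IsChar.zero, by simp⟩
  | insert i s hi ih =>
    obtain ⟨a, b, ha, hb, hab⟩ := h i (by simp)
    obtain ⟨a', b', ha', hb', hab'⟩ := ih (fun j hj => h j (by simp [hj]))
    refine ⟨_, _, ha.add ha', hb.add hb', fun g => ?_⟩
    have h2 := hab' g
    simp only at h2 ⊢
    rw [Finset.sum_insert hi, hab, h2]
    ring

theorem youngCount_isChar (n : ℕ) (a : Fin n → ℤ) : IsChar (fun g => (youngCount n a g : ℚ)) := by
  by_cases h : ∀ i, 0 ≤ a i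
  · have h1 := IsChar.perm (G := Equiv.Perm (Fin n))
      (X := {f : Fin n → Fin n // ∀ i : Fin n, Nat.card {x : Fin n // f x = i} = (a i).toNat})
      (fun g f => ⟨f.1 ∘ g, fun i => by
        rw [← f.2 i]
        exact Nat.card_congr (g.subtypeEquiv (fun x => Iff.rfl))⟩) rfl (fun g h => rfl)
    convert h1 using 2 with g
    unfold youngCount
    rw [if_pos h]
    rw [Int.cast_natCast, Nat.cast_inj]
    apply Nat.card_congr
    refine Equiv.trans (Equiv.subtypeEquivRight (fun f => and_comm)) ?_
    refine Equiv.trans (Equiv.subtypeSubtypeEquivSubtypeInter _ (fun f : Fin n → Fin n => f ∘ g = f)).symm ?_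
    exact Equiv.subtypeEquivRight (fun f => by rw [Subtype.ext_iff])
  · have : (fun g => (youngCount n a g : ℚ)) = fun _ => 0 := by
      ext g
      unfold youngCount
      rw [if_neg h]; simp
    rw [this]
    exact IsChar.zero

theorem irrChar_isVirt (n : ℕ) (l : Partition') : IsVirt (fun g => (irrChar n l g : ℚ)) := by
  unfold irrChar
  simp only [Int.cast_sum]
  apply IsVirt.sum
  intro σ _
  have h := youngCount_isChar n (fun i => (l.1 i : ℤ) + ((σ i : ℕ) : ℤ) - (i : ℤ))
  rcases Int.units_eq_one_or (Equiv.Perm.sign σ) with hs | hs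
  · exact ⟨_, _, h, IsChar.zero, by simp [hs]⟩
  · exact ⟨_, _, IsChar.zero, h, by simp [hs]⟩

theorem irrChar_conj (n : ℕ) (l : Partition') (g h : Equiv.Perm (Fin n)) (hc : IsConj g h) :
    irrChar n l g = irrChar n l h := by
  obtain ⟨_, _, ⟨V, _, _, _, ρ, rfl⟩, ⟨W, _, _, _, σ, rfl⟩, hf⟩ := irrChar_isVirt n l
  obtain ⟨c, rfl⟩ := isConj_iff.1 hc
  have h1 := hf g
  have h2 := hf (c * g * c⁻¹)
  rw [char_conj, char_conj, ← h1] at h2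
  have h3 : (irrChar n l (c * g * c⁻¹) : ℚ) = irrChar n l g := h2
  exact_mod_cast h3.symm

theorem irrChar_isChar (n : ℕ) (l : Partition') (hl : size l = n) : IsChar (fun g => (irrChar n l g : ℚ)) := by
  refine (irrChar_isVirt n l).isChar ?_ (by exact_mod_cast irrChar_one_nonneg n l)
  have : ∀ g : Equiv.Perm (Fin n), irrChar n l g⁻¹ = irrChar n l g := fun g =>
    irrChar_conj _ _ _ _ (Equiv.Perm.isConj_iff_cycleType_eq.2 (by simp))
  simp_rw [this]
  have := orth n l l hl hl
  rw [if_pos rfl] at this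
  rw [Fintype.card_perm, Fintype.card_fin]
  exact_mod_cast this

end HeisProof

namespace HeisProof
open Finset Partition'

abbrev Lam (n : ℕ) : Type := {l : Partition' // size l = n}

noncomputable def chi (n : ℕ) (l : Lam n) (g : Equiv.Perm (Fin n)) : ℚ := (irrChar n l.1 g : ℚ)

theorem chi_conj (n : ℕ) (l : Lam n) (g h : Equiv.Perm (Fin n)) (hc : IsConj g h) :
    chi n l g = chi n l h := by
  unfold chi
  rw [irrChar_conj n l.1 g h hc]

theorem chi_orth (n : ℕ) (l m : Lam n) :
    ∑ g, chi n l g * chi n m g = if l = m then (n.factorial : ℚ) else 0 := by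
  have h := orth n l.1 m.1 l.2 m.2
  have h2 : ∑ g, chi n l g * chi n m g = ((∑ g : Equiv.Perm (Fin n), irrChar n l.1 g * irrChar n m.1 g : ℤ) : ℚ) := by
    simp [chi]
  rw [h2, h]
  by_cases hlm : l = m
  · rw [if_pos hlm, if_pos (congrArg _ hlm)]; simp
  · rw [if_neg hlm, if_neg (fun h => hlm (Subtype.ext h))]; simp

/-- class function on conjugacy classes -/
noncomputable def chiC (n : ℕ) (l : Lam n) (c : ConjClasses (Equiv.Perm (Fin n))) : ℚ :=
  Quotient.lift (chi n l) (fun a b h => chi_conj n l a b h) c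

theorem chiC_mk (n : ℕ) (l : Lam n) (g : Equiv.Perm (Fin n)) :
    chiC n l (ConjClasses.mk g) = chi n l g := rfl

theorem fact_ne (n : ℕ) : (n.factorial : ℚ) ≠ 0 := by exact_mod_cast n.factorial_ne_zero

theorem coeff_of_sum (n : ℕ) (s : Finset (Lam n)) (c : Lam n → ℚ) (f : Equiv.Perm (Fin n) → ℚ)
    (h : ∀ g, f g = ∑ i ∈ s, c i * chi n i g) (j : Lam n) (hj : j ∈ s) :
    ∑ g, f g * chi n j g = n.factorial * c j := by
  simp_rw [h, Finset.sum_mul]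
  rw [Finset.sum_comm]
  simp_rw [mul_assoc, ← Finset.mul_sum, chi_orth]
  rw [Finset.sum_eq_single j]
  · simp [mul_comm]
  · intro b _ hb
    rw [if_neg hb, mul_zero]
  · intro h; exact absurd hj h

theorem chiC_linInd (n : ℕ) : LinearIndependent ℚ (chiC n) := by
  rw [linearIndependent_iff']
  intro s c hc j hj
  have h := coeff_of_sum n s c (fun _ => 0) (fun g => by
    have := congrFun hc (ConjClasses.mk g)
    simp only [Finset.sum_apply, Pi.smul_apply, smul_eq_mul, chiC_mk, Pi.zero_apply] at this
    exact this.symm) j hj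
  simp only [zero_mul, Finset.sum_const_zero] at h
  rcases mul_eq_zero.1 h.symm with h | h
  · exact absurd h (fact_ne n)
  · exact h

instance lam_finite (n : ℕ) : Finite (Lam n) := (chiC_linInd n).finite

noncomputable instance lam_fintype (n : ℕ) : Fintype (Lam n) := Fintype.ofFinite _

theorem sum_filter_aux (N : ℕ) (s : Multiset ℕ) (h : ∀ x ∈ s, x ≤ N) :
    ∑ i ∈ Finset.range N, (s.filter (fun x => i < x)).card = s.sum := by
  induction s using Multiset.induction_on with
  | empty => simp
  | cons a s ih =>
    have h2 := ih (fun x hx => h x (Multiset.mem_cons_of_mem hx))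
    have ha := h a (Multiset.mem_cons_self a s)
    simp only [Multiset.filter_cons, Multiset.card_add, Finset.sum_add_distrib, Multiset.sum_cons, h2]
    congr 1
    have : ∀ i, (Multiset.card (if i < a then ({a} : Multiset ℕ) else 0)) = if i < a then 1 else 0 := by
      intro i; split_ifs <;> simp
    simp only [this]
    rw [← Finset.card_filter]
    have : (Finset.range N).filter (fun i => i < a) = Finset.range a := by
      ext i; simp; omega
    rw [this, Finset.card_range]

theorem ofMs_mem (s : Multiset ℕ) :
    ∀ i, (s.filter (fun x => i < x)).card ≠ 0 → i ∈ Finset.range s.sum := by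
  intro i hi
  rw [Finset.mem_range]
  have h : (s.filter (fun x => i < x)) ≠ 0 := by
    intro h; rw [h] at hi; exact hi rfl
  obtain ⟨x, hx⟩ := Multiset.exists_mem_of_ne_zero h
  rw [Multiset.mem_filter] at hx
  exact lt_of_lt_of_le hx.2 (Multiset.le_sum_of_mem hx.1)

noncomputable def ofMs (s : Multiset ℕ) : Partition' :=
  ⟨Finsupp.onFinset (Finset.range s.sum) (fun i => (s.filter (fun x => i < x)).card) (ofMs_mem s), by
    intro i j hij
    apply Multiset.card_le_card
    apply Multiset.monotone_filter_right
    intro x hx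
    exact lt_of_le_of_lt hij hx⟩

theorem ofMs_size (s : Multiset ℕ) : size (ofMs s) = s.sum := by
  refine (Finsupp.sum_of_support_subset (s := Finset.range s.sum) (ofMs s).1
    (Finsupp.support_onFinset_subset (hf := ofMs_mem s)) (fun _ v => v) (fun _ _ => rfl)).trans ?_
  exact sum_filter_aux _ _ (fun x hx => Multiset.le_sum_of_mem hx)

theorem ofMs_inj (s t : Multiset ℕ) (hs : ∀ x ∈ s, 0 < x) (ht : ∀ x ∈ t, 0 < x)
    (h : ofMs s = ofMs t) : s = t := by
  have h1 : ∀ i, (s.filter (fun x => i < x)).card = (t.filter (fun x => i < x)).card := by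
    intro i
    have := DFunLike.congr_fun (congrArg Subtype.val h) i
    exact this
  have key : ∀ (s : Multiset ℕ) (i : ℕ), s.count (i + 1) + (s.filter (fun x => i + 1 < x)).card =
      (s.filter (fun x => i < x)).card := by
    intro s i
    induction s using Multiset.induction_on with
    | empty => simp
    | cons a s ih =>
      simp only [Multiset.filter_cons, Multiset.card_add, Multiset.count_cons]
      rcases lt_trichotomy a (i + 1) with h | h | h
      · rw [if_neg (by omega), if_neg (by omega), if_neg (by omega)]; simp; omega
      · rw [if_pos (by omega), if_neg (by omega), if_pos (by omega)]; simp; omega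
      · rw [if_neg (by omega), if_pos (by omega), if_pos (by omega)]; simp; omega
  ext x
  rcases x with _ | i
  · rw [Multiset.count_eq_zero_of_notMem (fun h => absurd (hs _ h) (lt_irrefl _)),
      Multiset.count_eq_zero_of_notMem (fun h => absurd (ht _ h) (lt_irrefl _))]
  · have a := key s i
    have b := key t i
    rw [h1, h1] at a
    omega

noncomputable def classToLam (n : ℕ) (c : ConjClasses (Equiv.Perm (Fin n))) : Lam n :=
  ⟨ofMs (Quotient.out c).partition.parts, by
    rw [ofMs_size, Nat.Partition.parts_sum, Fintype.card_fin]⟩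

theorem classToLam_inj (n : ℕ) : Function.Injective (classToLam n) := by
  intro c d h
  have h1 := ofMs_inj _ _ (fun x hx => Nat.Partition.parts_pos _ hx)
    (fun x hx => Nat.Partition.parts_pos _ hx) (congrArg Subtype.val h)
  have h2 := Equiv.Perm.partition_eq_of_isConj.2 (Nat.Partition.ext h1)
  rw [← Quotient.out_eq c, ← Quotient.out_eq d]
  exact Quotient.sound h2

theorem chiC_span (n : ℕ) : Submodule.span ℚ (Set.range (chiC n)) = ⊤ := by
  haveI : Fintype (ConjClasses (Equiv.Perm (Fin n))) := Fintype.ofFinite _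
  apply (chiC_linInd n).span_eq_top_of_card_eq_finrank'
  apply le_antisymm
  · exact (chiC_linInd n).fintype_card_le_finrank
  · rw [Module.finrank_fintype_fun_eq_card]
    exact Fintype.card_le_of_injective _ (classToLam_inj n)

theorem expand (n : ℕ) (f : Equiv.Perm (Fin n) → ℚ) (hf : ∀ g h, IsConj g h → f g = f h)
    (g : Equiv.Perm (Fin n)) :
    f g = ∑ l : Lam n, ((∑ h, f h * chi n l h) / n.factorial) * chi n l g := by
  let F : ConjClasses (Equiv.Perm (Fin n)) → ℚ := fun c => Quotient.lift f (fun a b h => hf a b h) c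
  have hF : F ∈ Submodule.span ℚ (Set.range (chiC n)) := by rw [chiC_span]; trivial
  obtain ⟨c, hc⟩ := (Submodule.mem_span_range_iff_exists_fun ℚ).1 hF
  have h1 : ∀ g, f g = ∑ l : Lam n, c l * chi n l g := by
    intro g
    have := congrFun hc (ConjClasses.mk g)
    simp only [Finset.sum_apply, Pi.smul_apply, smul_eq_mul, chiC_mk] at this
    exact this.symm
  rw [h1]
  refine Finset.sum_congr rfl fun l _ => ?_
  rw [coeff_of_sum n univ c f h1 l (mem_univ _), mul_div_cancel_left₀ _ (fact_ne n)]

end HeisProof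

namespace HeisProof
open Finset Partition'

theorem sumEmb_mul {a b : ℕ} (g g' : Equiv.Perm (Fin a)) (h h' : Equiv.Perm (Fin b)) :
    sumEmb (g * g') (h * h') = sumEmb g h * sumEmb g' h' := by
  ext x
  unfold sumEmb
  obtain ⟨y, rfl⟩ := finSumFinEquiv.surjective x
  rcases y with y | y <;> simp [Equiv.permCongr_apply]

theorem sumEmb_one {a b : ℕ} : sumEmb (1 : Equiv.Perm (Fin a)) (1 : Equiv.Perm (Fin b)) = 1 := by
  ext x
  unfold sumEmb
  obtain ⟨y, rfl⟩ := finSumFinEquiv.surjective x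
  rcases y with y | y <;> simp [Equiv.permCongr_apply]

def sumHom (a b : ℕ) : Equiv.Perm (Fin a) × Equiv.Perm (Fin b) →* Equiv.Perm (Fin (a + b)) where
  toFun p := sumEmb p.1 p.2
  map_one' := sumEmb_one
  map_mul' p q := sumEmb_mul _ _ _ _

theorem isConj_sumEmb {a b : ℕ} {g g' : Equiv.Perm (Fin a)} {h h' : Equiv.Perm (Fin b)}
    (h1 : IsConj g g') (h2 : IsConj h h') : IsConj (sumEmb g h) (sumEmb g' h') := by
  obtain ⟨c, rfl⟩ := isConj_iff.1 h1
  obtain ⟨d, rfl⟩ := isConj_iff.1 h2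
  have := (sumHom a b).map_isConj (a := (g, h)) (b := (c * g * c⁻¹, d * h * d⁻¹))
    (isConj_iff.2 ⟨(c, d), rfl⟩)
  exact this

theorem toNat_div_cast (S : ℤ) (N k : ℕ) (hN : N ≠ 0) (h : (S : ℚ) = N * k) :
    ((S / (N : ℤ)).toNat : ℚ) = (S : ℚ) / N := by
  have h1 : S = (N : ℤ) * k := by exact_mod_cast h
  have hN' : (N : ℤ) ≠ 0 := by exact_mod_cast hN
  have hq : (N : ℚ) ≠ 0 := by exact_mod_cast hN
  rw [h, h1, Int.mul_ediv_cancel_left _ hN', Int.toNat_natCast, mul_div_cancel_left₀ _ hq]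

theorem lr_eq {a b : ℕ} (α : Lam a) (β : Lam b) (l : Lam (a + b)) :
    (lr α.1 β.1 l.1 : ℚ) = (∑ g, ∑ h, chi a α g * chi b β h * chi (a + b) l (sumEmb g h)) /
      (a.factorial * b.factorial) := by
  obtain ⟨α, rfl⟩ := α
  obtain ⟨β, rfl⟩ := β
  obtain ⟨l, hl⟩ := l
  simp only
  unfold lr
  rw [if_pos hl]
  have c1 := (irrChar_isChar _ α rfl).comp (MonoidHom.fst (Equiv.Perm (Fin (size α))) (Equiv.Perm (Fin (size β))))
  have c2 := (irrChar_isChar _ β rfl).comp (MonoidHom.snd (Equiv.Perm (Fin (size α))) (Equiv.Perm (Fin (size β))))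
  have c3 := (irrChar_isChar _ l hl).comp (sumHom (size α) (size β))
  obtain ⟨k, hk⟩ := ((c1.mul c2).mul c3).sum_nat
  rw [Fintype.sum_prod_type, Fintype.card_prod, Fintype.card_perm, Fintype.card_perm, Fintype.card_fin,
    Fintype.card_fin] at hk
  have hS : ((∑ g : Equiv.Perm (Fin (size α)), ∑ h : Equiv.Perm (Fin (size β)),
        irrChar (size α) α g * irrChar (size β) β h *
          irrChar (size α + size β) l (sumEmb g h) : ℤ) : ℚ) =
      ((size α).factorial * (size β).factorial : ℕ) * k := by
    rw [← hk]
    push_cast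
    rfl
  have := toNat_div_cast _ _ k (Nat.mul_ne_zero (Nat.factorial_ne_zero _) (Nat.factorial_ne_zero _)) hS
  rw [Nat.cast_mul, Nat.cast_mul] at this
  rw [this]
  simp [chi]

theorem kron_eq {b : ℕ} (β η δ : Lam b) :
    (kron β.1 η.1 δ.1 : ℚ) = (∑ g, chi b β g * chi b η g * chi b δ g) / b.factorial := by
  obtain ⟨δ, rfl⟩ := δ
  obtain ⟨β, hβ⟩ := β
  obtain ⟨η, hη⟩ := η
  simp only
  unfold kron
  rw [if_pos ⟨hβ, hη⟩]
  obtain ⟨k, hk⟩ := (((irrChar_isChar _ β hβ).mul (irrChar_isChar _ η hη)).mul (irrChar_isChar _ δ rfl)).sum_nat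
  rw [Fintype.card_perm, Fintype.card_fin] at hk
  have hS : ((∑ g : Equiv.Perm (Fin (size δ)),
        irrChar (size δ) β g * irrChar (size δ) η g * irrChar (size δ) δ g : ℤ) : ℚ) =
      (size δ).factorial * k := by
    rw [← hk]
    push_cast
    rfl
  have := toNat_div_cast _ _ k (Nat.factorial_ne_zero _) hS
  rw [this]
  simp [chi]

theorem half_left {a b : ℕ} (α : Lam a) (l : Lam (a + b)) (u : Equiv.Perm (Fin b)) :
    ∑ g, chi (a + b) l (sumEmb g u) * chi a α g =
      a.factorial * ∑ β : Lam b, (lr α.1 β.1 l.1 : ℚ) * chi b β u := by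
  rw [expand b (fun u => ∑ g, chi (a + b) l (sumEmb g u) * chi a α g) (fun u v h => by
    refine Finset.sum_congr rfl fun g _ => ?_
    rw [chi_conj _ l _ _ (isConj_sumEmb (IsConj.refl g) h)]) u,
    Finset.mul_sum]
  refine Finset.sum_congr rfl fun β _ => ?_
  rw [← mul_assoc]
  congr 1
  have h1 := fact_ne a
  have h2 := fact_ne b
  have h3 : ∑ h, (∑ g, chi (a + b) l (sumEmb g h) * chi a α g) * chi b β h =
      ∑ g, ∑ h, chi a α g * chi b β h * chi (a + b) l (sumEmb g h) := by
    simp_rw [Finset.sum_mul]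
    rw [Finset.sum_comm]
    refine Finset.sum_congr rfl fun g _ => Finset.sum_congr rfl fun h _ => ?_
    ring
  rw [lr_eq, h3]
  field_simp

theorem half_right {a b : ℕ} (β : Lam b) (l : Lam (a + b)) (g : Equiv.Perm (Fin a)) :
    ∑ u, chi (a + b) l (sumEmb g u) * chi b β u =
      b.factorial * ∑ α : Lam a, (lr α.1 β.1 l.1 : ℚ) * chi a α g := by
  rw [expand a (fun g => ∑ u, chi (a + b) l (sumEmb g u) * chi b β u) (fun u v h => by
    refine Finset.sum_congr rfl fun g _ => ?_
    rw [chi_conj _ l _ _ (isConj_sumEmb h (IsConj.refl g))]) g,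
    Finset.mul_sum]
  refine Finset.sum_congr rfl fun α _ => ?_
  rw [← mul_assoc]
  congr 1
  have h1 := fact_ne a
  have h2 := fact_ne b
  rw [lr_eq]
  simp_rw [Finset.sum_mul]
  field_simp
  refine Finset.sum_congr rfl fun g _ => Finset.sum_congr rfl fun h _ => ?_
  ring

theorem chi_sumEmb {a b : ℕ} (l : Lam (a + b)) (g : Equiv.Perm (Fin a)) (u : Equiv.Perm (Fin b)) :
    chi (a + b) l (sumEmb g u) =
      ∑ α : Lam a, ∑ β : Lam b, (lr α.1 β.1 l.1 : ℚ) * (chi a α g * chi b β u) := by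
  rw [expand a (fun g => chi (a + b) l (sumEmb g u)) (fun g h hc =>
    chi_conj _ l _ _ (isConj_sumEmb hc (IsConj.refl u))) g]
  refine Finset.sum_congr rfl fun α _ => ?_
  rw [half_left, mul_div_cancel_left₀ _ (fact_ne a), Finset.sum_mul]
  refine Finset.sum_congr rfl fun β _ => ?_
  ring

end HeisProof

namespace HeisProof
open Finset Partition'

/-- the middle coefficient -/
noncomputable def nn {a b c : ℕ} (nu : Lam (a + b + c)) (α : Lam a) (δ : Lam b) (ρ : Lam c) : ℚ :=
  ∑ τ : Lam (a + b), (lr α.1 δ.1 τ.1 : ℚ) * lr τ.1 ρ.1 nu.1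

theorem chi_three {a b c : ℕ} (nu : Lam (a + b + c)) (g : Equiv.Perm (Fin a))
    (u : Equiv.Perm (Fin b)) (w : Equiv.Perm (Fin c)) :
    chi (a + b + c) nu (sumEmb (sumEmb g u) w) =
      ∑ α : Lam a, ∑ δ : Lam b, ∑ ρ : Lam c, nn nu α δ ρ * (chi a α g * chi b δ u * chi c ρ w) := by
  rw [chi_sumEmb]
  simp_rw [chi_sumEmb, nn, Finset.sum_mul, Finset.mul_sum]
  -- τ ρ α δ
  have h1 : ∀ F : Lam (a + b) → Lam c → Lam a → Lam b → ℚ,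
      ∑ τ, ∑ ρ, ∑ α, ∑ δ, F τ ρ α δ = ∑ α, ∑ δ, ∑ ρ, ∑ τ, F τ ρ α δ := by
    intro F
    rw [Finset.sum_comm]
    have : ∀ ρ, ∑ τ, ∑ α, ∑ δ, F τ ρ α δ = ∑ α, ∑ δ, ∑ τ, F τ ρ α δ := by
      intro ρ
      rw [Finset.sum_comm]
      refine Finset.sum_congr rfl fun α _ => ?_
      rw [Finset.sum_comm]
    simp_rw [this]
    rw [Finset.sum_comm]
    refine Finset.sum_congr rfl fun α _ => ?_
    rw [Finset.sum_comm]
  rw [h1]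
  refine Finset.sum_congr rfl fun α _ => Finset.sum_congr rfl fun δ _ =>
    Finset.sum_congr rfl fun ρ _ => Finset.sum_congr rfl fun τ _ => ?_
  ring

theorem main_Q {a b c : ℕ} (l : Lam (a + b)) (m : Lam (b + c)) (nu : Lam (a + b + c)) :
    ∑ g : Equiv.Perm (Fin a), ∑ u : Equiv.Perm (Fin b), ∑ w : Equiv.Perm (Fin c),
      chi _ l (sumEmb g u) * chi _ m (sumEmb u w) * chi _ nu (sumEmb (sumEmb g u) w) =
    (a.factorial * b.factorial * c.factorial : ℚ) *
      ∑ α : Lam a, ∑ β : Lam b, ∑ δ : Lam b, ∑ η : Lam b, ∑ ρ : Lam c, ∑ τ : Lam (a + b),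
        (lr α.1 β.1 l.1 * lr η.1 ρ.1 m.1 * kron β.1 η.1 δ.1 * lr α.1 δ.1 τ.1 * lr τ.1 ρ.1 nu.1 : ℚ) := by
  simp_rw [chi_three, Finset.mul_sum]
  have h1 : ∀ F : Equiv.Perm (Fin a) → Equiv.Perm (Fin b) → Equiv.Perm (Fin c) → Lam a → Lam b → Lam c → ℚ,
      ∑ g, ∑ u, ∑ w, ∑ α, ∑ δ, ∑ ρ, F g u w α δ ρ = ∑ α, ∑ δ, ∑ ρ, ∑ u, ∑ g, ∑ w, F g u w α δ ρ := by
    intro F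
    have e1 : ∀ (P : Equiv.Perm (Fin b) × Equiv.Perm (Fin a) × Equiv.Perm (Fin c) → Lam a × Lam b × Lam c → ℚ),
        ∑ p, ∑ q, P p q = ∑ q, ∑ p, P p q := fun P => Finset.sum_comm
    have e2 := e1 (fun p q => F p.2.1 p.1 p.2.2 q.1 q.2.1 q.2.2)
    simp only [Fintype.sum_prod_type] at e2
    rw [← e2, Finset.sum_comm]
  rw [h1]
  have h2 : ∀ (α : Lam a) (δ : Lam b) (ρ : Lam c), ∑ u, ∑ g, ∑ w,
      chi _ l (sumEmb g u) * chi _ m (sumEmb u w) * (nn nu α δ ρ * (chi a α g * chi b δ u * chi c ρ w)) =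
      ∑ β : Lam b, ∑ η : Lam b, (a.factorial * b.factorial * c.factorial : ℚ) *
       (lr α.1 β.1 l.1 * lr η.1 ρ.1 m.1 * kron β.1 η.1 δ.1 * nn nu α δ ρ) := by
    intro α δ ρ
    have h3 : ∀ u, ∑ g, ∑ w,
      chi _ l (sumEmb g u) * chi _ m (sumEmb u w) * (nn nu α δ ρ * (chi a α g * chi b δ u * chi c ρ w)) =
      nn nu α δ ρ * chi b δ u * ((∑ g, chi _ l (sumEmb g u) * chi a α g) * (∑ w, chi _ m (sumEmb u w) * chi c ρ w)) := by
      intro u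
      rw [Finset.sum_mul_sum]
      simp_rw [Finset.mul_sum]
      refine Finset.sum_congr rfl fun g _ => Finset.sum_congr rfl fun w _ => ?_
      ring
    simp_rw [h3, half_left, half_right]
    have h4 : ∀ u, nn nu α δ ρ * chi b δ u * ((a.factorial * ∑ β : Lam b, (lr α.1 β.1 l.1 : ℚ) * chi b β u) *
        (c.factorial * ∑ η : Lam b, (lr η.1 ρ.1 m.1 : ℚ) * chi b η u)) =
        ∑ β : Lam b, ∑ η : Lam b, (nn nu α δ ρ * a.factorial * c.factorial * lr α.1 β.1 l.1 * lr η.1 ρ.1 m.1) *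
          (chi b β u * chi b η u * chi b δ u) := by
      intro u
      rw [mul_mul_mul_comm (a.factorial : ℚ), Finset.sum_mul_sum]
      simp_rw [Finset.mul_sum]
      refine Finset.sum_congr rfl fun g _ => Finset.sum_congr rfl fun w _ => ?_
      ring
    simp_rw [h4]
    rw [Finset.sum_comm]
    refine Finset.sum_congr rfl fun β _ => ?_
    rw [Finset.sum_comm]
    refine Finset.sum_congr rfl fun η _ => ?_
    rw [← Finset.mul_sum, kron_eq]
    have := fact_ne b
    field_simp
  simp_rw [h2]
  refine Finset.sum_congr rfl fun α _ => ?_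
  have h5 : ∀ F : Lam b → Lam c → Lam b → Lam b → ℚ,
      ∑ δ, ∑ ρ, ∑ β, ∑ η, F δ ρ β η = ∑ β, ∑ δ, ∑ η, ∑ ρ, F δ ρ β η := by
    intro F
    have : ∀ δ, ∑ ρ, ∑ β, ∑ η, F δ ρ β η = ∑ β, ∑ η, ∑ ρ, F δ ρ β η := by
      intro δ
      rw [Finset.sum_comm]
      refine Finset.sum_congr rfl fun α _ => ?_
      rw [Finset.sum_comm]
    simp_rw [this]
    rw [Finset.sum_comm]
  rw [h5]
  refine Finset.sum_congr rfl fun β _ => Finset.sum_congr rfl fun δ _ =>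
    Finset.sum_congr rfl fun η _ => Finset.sum_congr rfl fun ρ _ => ?_
  rw [nn]
  simp_rw [Finset.mul_sum]
  refine Finset.sum_congr rfl fun τ _ => ?_
  ring

theorem finsum_lam (n : ℕ) (F : Partition' → ℕ) (h : ∀ x, size x ≠ n → F x = 0) :
    ∑ᶠ x, F x = ∑ x : Lam n, F x.1 := by
  have h1 : ∑ x : Lam n, F x.1 = ∑ x ∈ (univ : Finset (Lam n)).map (Function.Embedding.subtype _), F x := by
    rw [Finset.sum_map]
    rfl
  rw [h1]
  apply finsum_eq_sum_of_support_subset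
  intro x hx
  rw [Function.mem_support] at hx
  have : size x = n := by
    by_contra hn
    exact hx (h x hn)
  simpa using this

theorem term_sizes (α β δ η ρ τ l m nu : Partition')
    (h : lr α β l * lr η ρ m * kron β η δ * lr α δ τ * lr τ ρ nu ≠ 0) :
    size l = size α + size β ∧ size m = size η + size ρ ∧ size β = size δ ∧ size η = size δ ∧
      size τ = size α + size δ ∧ size nu = size τ + size ρ := by
  have lr0 : ∀ a b c, lr a b c ≠ 0 → size c = size a + size b := by
    intro a b c h
    by_contra hn
    exact h (if_neg hn)
  have kr0 : ∀ a b c, kron a b c ≠ 0 → size a = size c ∧ size b = size c := by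
    intro a b c h
    by_contra hn
    exact h (if_neg hn)
  simp only [ne_eq, mul_eq_zero, not_or] at h
  obtain ⟨⟨⟨⟨h1, h2⟩, h3⟩, h4⟩, h5⟩ := h
  exact ⟨lr0 _ _ _ h1, lr0 _ _ _ h2, (kr0 _ _ _ h3).1, (kr0 _ _ _ h3).2, lr0 _ _ _ h4, lr0 _ _ _ h5⟩

theorem irrChar_cast {n n' : ℕ} (h : n = n') (l : Partition') (g : Equiv.Perm (Fin n)) :
    irrChar n' l ((finCongr h).permCongr g) = irrChar n l g := by
  subst h
  congr 1

theorem finsum_zero' {F : Partition' → ℕ} (h : ∀ x, F x = 0) : ∑ᶠ x, F x = 0 := by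
  rw [show F = fun _ => 0 from funext h]
  exact finsum_zero

theorem sum_case (a b c : ℕ) (l m nu : Partition') (hl : size l = a + b) (hm : size m = b + c)
    (hn : size nu = a + b + c) :
    ∑ᶠ (α : Partition') (β : Partition') (δ : Partition') (η : Partition')
        (ρ : Partition') (τ : Partition'),
        lr α β l * lr η ρ m * kron β η δ * lr α δ τ * lr τ ρ nu =
    ∑ α : Lam a, ∑ β : Lam b, ∑ δ : Lam b, ∑ η : Lam b, ∑ ρ : Lam c, ∑ τ : Lam (a + b),
        lr α.1 β.1 l * lr η.1 ρ.1 m * kron β.1 η.1 δ.1 * lr α.1 δ.1 τ.1 * lr τ.1 ρ.1 nu := by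
  have key : ∀ α β δ η ρ τ, ¬ (size α = a ∧ size β = b ∧ size δ = b ∧ size η = b ∧ size ρ = c ∧ size τ = a + b) →
      lr α β l * lr η ρ m * kron β η δ * lr α δ τ * lr τ ρ nu = 0 := by
    intro α β δ η ρ τ h
    by_contra h0
    have := term_sizes _ _ _ _ _ _ _ _ _ h0
    omega
  rw [finsum_lam a _ (fun α h => finsum_zero' fun β => finsum_zero' fun δ => finsum_zero' fun η =>
    finsum_zero' fun ρ => finsum_zero' fun τ => key α β δ η ρ τ (by tauto))]
  refine Finset.sum_congr rfl fun α _ => ?_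
  rw [finsum_lam b _ (fun β h => finsum_zero' fun δ => finsum_zero' fun η =>
    finsum_zero' fun ρ => finsum_zero' fun τ => key α.1 β δ η ρ τ (by tauto))]
  refine Finset.sum_congr rfl fun β _ => ?_
  rw [finsum_lam b _ (fun δ h => finsum_zero' fun η =>
    finsum_zero' fun ρ => finsum_zero' fun τ => key α.1 β.1 δ η ρ τ (by tauto))]
  refine Finset.sum_congr rfl fun δ _ => ?_
  rw [finsum_lam b _ (fun η h =>
    finsum_zero' fun ρ => finsum_zero' fun τ => key α.1 β.1 δ.1 η ρ τ (by tauto))]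
  refine Finset.sum_congr rfl fun η _ => ?_
  rw [finsum_lam c _ (fun ρ h => finsum_zero' fun τ => key α.1 β.1 δ.1 η.1 ρ τ (by tauto))]
  refine Finset.sum_congr rfl fun ρ _ => ?_
  rw [finsum_lam (a + b) _ (fun τ h => key α.1 β.1 δ.1 η.1 ρ.1 τ (by tauto))]

theorem main_proof (l m nu : Partition') :
    heisMult l m nu =
      ∑ᶠ (α : Partition') (β : Partition') (δ : Partition') (η : Partition')
        (ρ : Partition') (τ : Partition'),
        lr α β l * lr η ρ m * kron β η δ * lr α δ τ * lr τ ρ nu := by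
  by_cases h : size m ≤ size nu ∧ size l ≤ size nu ∧ size nu ≤ size l + size m
  · unfold heisMult
    rw [dif_pos h]
    simp only [irrChar_cast]
    generalize ha : size nu - size m = a
    generalize hb : size l + size m - size nu = b
    generalize hc : size nu - size l = c
    have hl : size l = a + b := by omega
    have hm : size m = b + c := by omega
    have hn : size nu = a + b + c := by omega
    rw [sum_case a b c l m nu hl hm hn]
    have key := main_Q (⟨l, hl⟩ : Lam (a + b)) (⟨m, hm⟩ : Lam (b + c)) (⟨nu, hn⟩ : Lam (a + b + c))
    simp only [chi] at key
    have key2 : ∑ g : Equiv.Perm (Fin a), ∑ u : Equiv.Perm (Fin b), ∑ w : Equiv.Perm (Fin c),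
        irrChar (a + b) l (sumEmb g u) * irrChar (b + c) m (sumEmb u w) *
          irrChar (a + b + c) nu (sumEmb (sumEmb g u) w) =
        ((a.factorial : ℤ) * (b.factorial : ℤ) * (c.factorial : ℤ)) *
        ((∑ α : Lam a, ∑ β : Lam b, ∑ δ : Lam b, ∑ η : Lam b, ∑ ρ : Lam c, ∑ τ : Lam (a + b),
        lr α.1 β.1 l * lr η.1 ρ.1 m * kron β.1 η.1 δ.1 * lr α.1 δ.1 τ.1 * lr τ.1 ρ.1 nu : ℕ) : ℤ) := by
      exact_mod_cast key
    rw [key2, Int.mul_ediv_cancel_left, Int.toNat_natCast]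
    have f1 := Nat.factorial_ne_zero a
    have f2 := Nat.factorial_ne_zero b
    have f3 := Nat.factorial_ne_zero c
    exact_mod_cast Nat.mul_ne_zero (Nat.mul_ne_zero f1 f2) f3
  · unfold heisMult
    rw [dif_neg h]
    symm
    refine finsum_zero' fun α => finsum_zero' fun β => finsum_zero' fun δ => finsum_zero' fun η =>
      finsum_zero' fun ρ => finsum_zero' fun τ => ?_
    by_contra h0
    have := term_sizes _ _ _ _ _ _ _ _ _ h0
    omega

end HeisProof


open Partition' in
/-- For all partitions `λ, μ, ν`, the multiplicity of `M_ν` in the Heisenberg product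
`M_λ ♯ M_μ` equals `Σ_{α,β,δ,η,ρ,τ} c_{α,β}^λ c_{η,ρ}^μ g_{β,η,δ} c_{α,δ}^τ c_{τ,ρ}^ν`. -/
theorem heisMult_eq_aguiar_sum (l m nu : Partition') :
    heisMult l m nu =
      ∑ᶠ (α : Partition') (β : Partition') (δ : Partition') (η : Partition')
        (ρ : Partition') (τ : Partition'),
        lr α β l * lr η ρ m * kron β η δ * lr α δ τ * lr τ ρ nu :=
  HeisProof.main_proof l m nu
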